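/- arXiv:2204.01317 — 2 statements merged into one kernel-verified Lean document; each statement's English description precedes it below -/
import Mathlib

section
/- If tr(ω) is a proper ideal of the Hibi ring R(P) (i.e. the non-Gorenstein locus is non-empty), then the Krull dimension of R(P)/tr(ω) is at most #P − 3; equivalently, the codimension of the non-Gorenstein locus in Spec(R(P)) (which has Krull dimension #P + 1) is at least 4. -/
noncomputable section

/-- `ψ : Q → ℤ` is a grading of the poset `Q`: it drops by exactly one along every covering
relation (functions here are order-reversing, matching the conventions for Hibi rings). -/
def IsGrading (Q : Type*) [PartialOrder Q] (ψ : Q → ℤ) : Prop :=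
  ∀ a b : Q, a ⋖ b → ψ a = ψ b + 1

/-- a poset is graded if it admits a grading -/
def IsGradedPoset (Q : Type*) [PartialOrder Q] : Prop :=
  ∃ ψ : Q → ℤ, IsGrading Q ψ

/-- a subset `A` of a poset is connected: any two of its elements are joined by a finite
sequence inside `A` in which consecutive elements are comparable -/
def ConnSubset {Q : Type*} [PartialOrder Q] (A : Set Q) : Prop :=
  ∀ x ∈ A, ∀ y ∈ A,
    Relation.ReflTransGen (fun p q : Q => p ∈ A ∧ q ∈ A ∧ (p ≤ q ∨ q ≤ p)) x y

/-- a subset `A` of a poset is order-convex: `a ≤ b ≤ c` with `a, c ∈ A` implies `b ∈ A` -/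
def OrderConvex {Q : Type*} [PartialOrder Q] (A : Set Q) : Prop :=
  ∀ a b c : Q, a ≤ b → b ≤ c → a ∈ A → c ∈ A → b ∈ A

/-- a complete subset: nonempty, connected and order-convex (exactly the subsets occurring as
fibres of quotient poset maps) -/
def CompleteSubset {Q : Type*} [PartialOrder Q] (A : Set Q) : Prop :=
  A.Nonempty ∧ ConnSubset A ∧ OrderConvex A

/-- `φ : Q → Q'` is a quotient poset map: surjective, order preserving, with connected fibres,
such that the order on `Q'` is the transitive closure of the relation
`a' ≤ b' ↔ ∃ a ∈ φ⁻¹(a'), b ∈ φ⁻¹(b'), a ≤ b`. -/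
def IsQuotientPosetMap {Q Q' : Type*} [PartialOrder Q] [PartialOrder Q']
    (φ : Q → Q') : Prop :=
  Function.Surjective φ ∧ Monotone φ ∧ (∀ q' : Q', ConnSubset (φ ⁻¹' {q'})) ∧
    ∀ a' b' : Q', a' ≤ b' ↔
      Relation.TransGen (fun x' y' : Q' => ∃ a b : Q, φ a = x' ∧ φ b = y' ∧ a ≤ b) a' b'


set_option synthInstance.maxHeartbeats 1000000
set_option maxHeartbeats 1000000

/-- `P̄ = P ∪ {-∞, ∞}`: the poset `P` with a new minimum and a new maximum adjoined -/
abbrev Pbar (P : Type) [PartialOrder P] : Type := WithBot (WithTop P)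

variable (k : Type) [Field k] (P : Type) [Fintype P] [PartialOrder P]

/-- the monomial `χ^ψ` in the Laurent polynomial ring -/
def hibiMono (ψ : Pbar P → ℤ) : AddMonoidAlgebra k (Pbar P → ℤ) :=
  AddMonoidAlgebra.single ψ 1

/-- a lattice point of the cone `C(P)`: an order-reversing integral function on `P̄`
with `ψ(∞) = 0` -/
def InConeP (ψ : Pbar P → ℤ) : Prop := Antitone ψ ∧ ψ ⊤ = 0

/-- the Hibi ring `R(P) = k[C(P) ∩ ℤ^{P ∪ {-∞}}]`, the subalgebra of the Laurent polynomial
ring spanned by the monomials `χ^ψ` with `ψ` an integral point of `C(P)` -/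
def hibiRing : Subalgebra k (AddMonoidAlgebra k (Pbar P → ℤ)) :=
  Algebra.adjoin k {f | ∃ ψ : Pbar P → ℤ, InConeP P ψ ∧ f = hibiMono k P ψ}

/-- the canonical module `ω` of the Hibi ring: spanned by the monomials `χ^ψ` with `ψ`
integral, `ψ(∞) = 0` and `ψ a ≥ ψ b + 1` for every covering relation `a ⋖ b` of `P̄` -/
def hibiOmega : Submodule ↥(hibiRing k P) (AddMonoidAlgebra k (Pbar P → ℤ)) :=
  Submodule.span ↥(hibiRing k P)
    {f | ∃ ψ : Pbar P → ℤ, ψ ⊤ = 0 ∧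
      (∀ a b : Pbar P, a ⋖ b → ψ b + 1 ≤ ψ a) ∧ f = hibiMono k P ψ}

/-- the trace ideal `tr(ω)` of the canonical module of the Hibi ring -/
def hibiTrace : Ideal ↥(hibiRing k P) :=
  Ideal.span {r | ∃ (φ : ↥(hibiOmega k P) →ₗ[↥(hibiRing k P)] ↥(hibiRing k P))
    (x : ↥(hibiOmega k P)), φ x = r}

end

section KrullDimension

theorem ringKrullDim_le_of_algebraIsIntegral (R S : Type*) [CommRing R] [CommRing S]
    [Algebra R S] [Algebra.IsIntegral R S] : ringKrullDim S ≤ ringKrullDim R :=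
  Order.krullDim_le_of_strictMono (PrimeSpectrum.comap (algebraMap R S))
    fun _ _ h => Ideal.IsIntegral.comap_lt_comap h

/-- A finitely generated algebra that is a quotient of a subalgebra of a polynomial ring in
finitely many variables has Krull dimension at most the number of variables. -/
theorem ringKrullDim_le_of_subquotient_mvPolynomial {k A B σ : Type} [Field k] [CommRing A]
    [CommRing B] [Algebra k A] [Algebra k B] [Algebra.FiniteType k A] [Fintype σ]
    (f : B →ₐ[k] A) (hf : Function.Surjective f)
    (g : B →ₐ[k] MvPolynomial σ k) (hg : Function.Injective g) :
    ringKrullDim A ≤ Fintype.card σ := by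
  rcases subsingleton_or_nontrivial A with hA | hA
  · rw [ringKrullDim_eq_bot_of_subsingleton]
    exact bot_le
  obtain ⟨s, e, he, hint⟩ := exists_integral_inj_algHom_of_fg k A
  have hs : s ≤ Fintype.card σ := by
    choose y hy using fun i => hf (e (MvPolynomial.X i))
    have hcomp : f.comp (MvPolynomial.aeval y) = e := by
      ext i
      simp [hy]
    have hinj : Function.Injective (MvPolynomial.aeval y : _ →ₐ[k] B) := by
      refine Function.Injective.of_comp (f := f) ?_
      rw [← AlgHom.coe_comp, hcomp]
      exact he
    have := trdeg_le_of_injective (g.comp (MvPolynomial.aeval y)) (hg.comp hinj)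
    simpa [MvPolynomial.trdeg_of_isDomain] using this
  let := e.toRingHom.toAlgebra
  have : Algebra.IsIntegral (MvPolynomial (Fin s) k) A := ⟨hint⟩
  calc ringKrullDim A ≤ ringKrullDim (MvPolynomial (Fin s) k) :=
        ringKrullDim_le_of_algebraIsIntegral _ _
    _ = s := by simp
    _ ≤ _ := by exact_mod_cast hs

/-- The dimension of a quotient ring is bounded by the dimensions of its quotient domains. -/
theorem ringKrullDim_quotient_le_of_forall_isPrime {R : Type*} [CommRing R] (I : Ideal R)
    (n : WithBot ℕ∞)
    (h : ∀ p : Ideal R, p.IsPrime → I ≤ p → ringKrullDim (R ⧸ p) ≤ n) :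
    ringKrullDim (R ⧸ I) ≤ n := by
  rw [ringKrullDim_quotient]
  refine iSup_le fun l => ?_
  refine le_trans ?_ (h l.head.1.asIdeal l.head.1.isPrime l.head.2)
  rw [ringKrullDim_quotient]
  let l' : LTSeries (PrimeSpectrum.zeroLocus (R := R) (l.head.1.asIdeal : Set R)) :=
    { length := l.length
      toFun := fun i => ⟨(l i).1, show l.head.1.asIdeal ≤ (l i).1.asIdeal from
        l.monotone (Fin.zero_le i)⟩
      step := fun i => l.step i }
  exact le_iSup (fun q : LTSeries _ => (q.length : WithBot ℕ∞)) l'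

end KrullDimension

section Potential

variable {V : Type*} {G : SimpleGraph V}

/-- The sum of the weights `s u v` over the steps `u → v` of a walk. -/
def SimpleGraph.Walk.weight (s : V → V → ℤ) {u v : V} (p : G.Walk u v) : ℤ :=
  (p.darts.map fun d => s d.fst d.snd).sum

namespace SimpleGraph.Walk

theorem weight_nil (s : V → V → ℤ) (u : V) : (nil : G.Walk u u).weight s = 0 := rfl

theorem weight_cons (s : V → V → ℤ) {u v w : V} (h : G.Adj u v) (p : G.Walk v w) :
    (cons h p).weight s = s u v + p.weight s := by
  simp [weight]

theorem weight_append (s : V → V → ℤ) {u v w : V} (p : G.Walk u v) (q : G.Walk v w) :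
    (p.append q).weight s = p.weight s + q.weight s := by
  simp [weight]

theorem weight_bypass [DecidableEq V] (s : V → V → ℤ)
    (hs : ∀ u v (h : G.Adj u v) (q : G.Walk v u), q.IsPath → (cons h q).weight s = 0)
    {u v : V} (p : G.Walk u v) : p.bypass.weight s = p.weight s := by
  induction p with
  | nil => rfl
  | @cons u v w h p ih =>
    rw [weight_cons, ← ih, bypass]
    split_ifs with hu
    · have h1 := hs u v h (p.bypass.takeUntil u hu) (p.bypass_isPath.takeUntil hu)
      have h2 := congrArg (weight s) (p.bypass.take_spec hu)
      rw [weight_append] at h2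
      rw [weight_cons] at h1
      linarith
    · rw [weight_cons]

end SimpleGraph.Walk

open SimpleGraph in
/-- An edge weighting with vanishing sum along all cycles is the difference of a potential. -/
theorem SimpleGraph.exists_potential (s : V → V → ℤ)
    (hs : ∀ u v (h : G.Adj u v) (q : G.Walk v u), q.IsPath → (Walk.cons h q).weight s = 0) :
    ∃ φ : V → ℤ, ∀ u v, G.Adj u v → φ u = s u v + φ v := by
  classical
  have hclosed : ∀ u (p : G.Walk u u), p.weight s = 0 := by
    intro u p
    rw [← Walk.weight_bypass s hs, (Walk.isPath_iff_nil.mp p.bypass_isPath).eq_nil, Walk.weight_nil]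
  have huniq : ∀ u v v' (p : G.Walk u v) (q : G.Walk u v'), v = v' →
      p.weight s = q.weight s := by
    rintro u v _ p q rfl
    have h1 := hclosed u (p.append q.reverse)
    have h2 := hclosed u (q.append q.reverse)
    rw [Walk.weight_append] at h1 h2
    linarith
  have hreach : ∀ u, G.Reachable u (G.connectedComponentMk u).out := fun u =>
    (ConnectedComponent.exact (Quot.out_eq (G.connectedComponentMk u))).symm
  refine ⟨fun u => (hreach u).some.weight s, fun u v h => ?_⟩
  rw [← Walk.weight_cons s h]
  exact huniq _ _ _ _ _ (congrArg Quot.out (ConnectedComponent.sound h.reachable))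

end Potential

section CoverWeight

variable {Q : Type*} [PartialOrder Q]

open Classical in
/-- `1` on upward steps and `-1` on all others. -/
noncomputable def stepSign (a b : Q) : ℤ := if a < b then 1 else -1

theorem stepSign_of_lt {a b : Q} (h : a < b) : stepSign a b = 1 := if_pos h

theorem stepSign_of_gt {a b : Q} (h : b < a) : stepSign a b = -1 := if_neg h.not_gt

open SimpleGraph in
/-- Closed walks with at most four steps in a graph of covering relations are balanced. -/
theorem weight_cons_stepSign_eq_zero {G : SimpleGraph Q}
    (hG : ∀ a b, G.Adj a b → a ⋖ b ∨ b ⋖ a) {u v : Q} (h : G.Adj u v) (q : G.Walk v u)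
    (hq : q.length ≤ 3) : (Walk.cons h q).weight stepSign = 0 := by
  have key : ∀ a b, G.Adj a b →
      (a < b ∧ (∀ c, a < c → ¬ c < b) ∧ stepSign a b = 1) ∨
      (b < a ∧ (∀ c, b < c → ¬ c < a) ∧ stepSign a b = -1) := by
    intro a b hab
    rcases hG a b hab with h | h
    · exact Or.inl ⟨h.lt, fun c => @h.2 c, stepSign_of_lt h.lt⟩
    · exact Or.inr ⟨h.lt, fun c => @h.2 c, stepSign_of_gt h.lt⟩
  rw [Walk.weight_cons]
  cases q with
  | nil => exact absurd rfl h.ne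
  | @cons _ w _ h1 q =>
  rw [Walk.weight_cons]
  cases q with
  | nil =>
    rw [Walk.weight_nil]
    rcases key _ _ h with ⟨a1, a2, a3⟩ | ⟨a1, a2, a3⟩ <;>
    rcases key _ _ h1 with ⟨b1, b2, b3⟩ | ⟨b1, b2, b3⟩ <;>
    first
    | (rw [a3, b3]; rfl)
    | (exfalso; order)
  | @cons _ x _ h2 q =>
  rw [Walk.weight_cons]
  cases q with
  | nil =>
    exfalso
    rcases key _ _ h with ⟨a1, a2, a3⟩ | ⟨a1, a2, a3⟩ <;>
    rcases key _ _ h1 with ⟨b1, b2, b3⟩ | ⟨b1, b2, b3⟩ <;>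
    rcases key _ _ h2 with ⟨c1, c2, c3⟩ | ⟨c1, c2, c3⟩ <;>
    first
    | exact a2 _ c1 b1
    | exact a2 _ b1 c1
    | exact b2 _ a1 c1
    | exact b2 _ c1 a1
    | exact c2 _ a1 b1
    | exact c2 _ b1 a1
    | order
  | @cons _ y _ h3 q =>
  rw [Walk.weight_cons]
  cases q with
  | nil =>
    rw [Walk.weight_nil]
    rcases key _ _ h with ⟨a1, a2, a3⟩ | ⟨a1, a2, a3⟩ <;>
    rcases key _ _ h1 with ⟨b1, b2, b3⟩ | ⟨b1, b2, b3⟩ <;>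
    rcases key _ _ h2 with ⟨c1, c2, c3⟩ | ⟨c1, c2, c3⟩ <;>
    rcases key _ _ h3 with ⟨d1, d2, d3⟩ | ⟨d1, d2, d3⟩ <;>
    first
    | (rw [a3, b3, c3, d3]; rfl)
    | exact (a2 _ b1 (c1.trans d1)).elim
    | exact (b2 _ c1 (d1.trans a1)).elim
    | exact (c2 _ d1 (a1.trans b1)).elim
    | exact (d2 _ a1 (b1.trans c1)).elim
    | exact (a2 _ d1 (c1.trans b1)).elim
    | exact (b2 _ a1 (d1.trans c1)).elim
    | exact (c2 _ b1 (a1.trans d1)).elim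
    | exact (d2 _ c1 (b1.trans a1)).elim
    | (exfalso; order)
  | cons h4 q =>
    simp only [Walk.length_cons] at hq
    omega

open SimpleGraph in
/-- If all paths in a graph of covering relations have at most three edges, then the graph
has a grading. -/
theorem exists_grading_of_path_length_le {G : SimpleGraph Q}
    (hG : ∀ a b, G.Adj a b → a ⋖ b ∨ b ⋖ a)
    (hpath : ∀ u v (q : G.Walk u v), q.IsPath → q.length ≤ 3) :
    ∃ φ : Q → ℤ, ∀ a b, G.Adj a b → a < b → φ a = φ b + 1 := by
  obtain ⟨φ, hφ⟩ := SimpleGraph.exists_potential (G := G) stepSign fun u v h q hq =>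
    weight_cons_stepSign_eq_zero hG h q (hpath _ _ q hq)
  refine ⟨φ, fun a b h hab => ?_⟩
  rw [hφ a b h, stepSign_of_lt hab, add_comm]

end CoverWeight

section Hibi

theorem card_pbar (P : Type) [Fintype P] [PartialOrder P] [Fintype (Pbar P)] :
    Fintype.card (Pbar P) = Fintype.card P + 2 := by
  rw [← Nat.card_eq_fintype_card, ← Nat.card_eq_fintype_card]
  exact (Finite.card_option (α := Option P)).trans (congrArg (· + 1) Finite.card_option)

instance finite_pbar (P : Type) [Fintype P] [PartialOrder P] : Finite (Pbar P) :=
  inferInstanceAs (Finite (Option (Option P)))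

theorem antitone_of_forall_covBy {Q : Type*} [PartialOrder Q] [Finite Q] {ψ : Q → ℤ}
    (h : ∀ a b, a ⋖ b → ψ b ≤ ψ a) : Antitone ψ := by
  classical
  have := Fintype.ofFinite Q
  let := Fintype.toLocallyFiniteOrder (α := Q)
  exact (antitone_iff_forall_covBy ψ).2 h

/-- The monoid of lattice points of the cone `C(P)`. -/
def hibiCone (P : Type) [PartialOrder P] : AddSubmonoid (Pbar P → ℤ) where
  carrier := {ψ | InConeP P ψ}
  add_mem' := fun ha hb => ⟨ha.1.add hb.1, by simp [ha.2, hb.2]⟩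
  zero_mem' := ⟨antitone_const, rfl⟩

theorem InConeP.nonneg {P : Type} [PartialOrder P] {ψ : Pbar P → ℤ} (h : InConeP P ψ)
    (a : Pbar P) : 0 ≤ ψ a :=
  h.2 ▸ h.1 le_top

/-- Every lattice point of `C(P)` is a sum of lattice points with values in `{0, 1}`. -/
theorem hibiCone_fg (P : Type) [Fintype P] [PartialOrder P] : (hibiCone P).FG := by
  rw [AddSubmonoid.fg_iff]
  refine ⟨{ψ | InConeP P ψ ∧ ∀ a, ψ a ∈ Set.Icc (0 : ℤ) 1}, le_antisymm ?_ ?_, ?_⟩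
  · exact (AddSubmonoid.closure_le (S := hibiCone P)).2 fun ψ hψ => hψ.1
  · suffices H : ∀ (n : ℕ) (ψ : Pbar P → ℤ), InConeP P ψ → ψ ⊥ = n →
        ψ ∈ AddSubmonoid.closure {ψ | InConeP P ψ ∧ ∀ a, ψ a ∈ Set.Icc (0 : ℤ) 1} from
      fun ψ (hψ : InConeP P ψ) => H (ψ ⊥).toNat ψ hψ (Int.toNat_of_nonneg (hψ.nonneg ⊥)).symm
    intro n
    induction n with
    | zero =>
      intro ψ hψ h0
      have : ψ = 0 := funext fun a =>
        le_antisymm ((hψ.1 bot_le).trans (by simp [h0])) (hψ.nonneg a)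
      rw [this]
      exact zero_mem _
    | succ n ih =>
      intro ψ hψ hn
      have h1 : InConeP P fun a => min (ψ a) 1 :=
        ⟨fun a b hab => min_le_min_right 1 (hψ.1 hab), by simp [hψ.2]⟩
      have h2 : InConeP P fun a => ψ a - min (ψ a) 1 :=
        ⟨fun a b hab => by have := hψ.1 hab; dsimp only; omega, by simp [hψ.2]⟩
      have hsum : ψ = (fun a => ψ a - min (ψ a) 1) + fun a => min (ψ a) 1 := by
        ext a
        simp
      rw [hsum]
      refine add_mem (ih _ h2 ?_) (AddSubmonoid.subset_closure ⟨h1, fun a => ⟨?_, ?_⟩⟩)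
      · rw [hn]; push_cast; omega
      · exact le_min (hψ.nonneg a) zero_le_one
      · exact min_le_right _ _
  · refine Set.Finite.subset (Set.Finite.pi' fun _ : Pbar P => Set.finite_Icc (0 : ℤ) 1) ?_
    exact fun ψ hψ => hψ.2

variable {k : Type} [Field k] {P : Type} [PartialOrder P]

variable (k) in
/-- The monomial of a lattice point of `C(P)`, as an element of the Hibi ring. -/
noncomputable def hibiRingMono (ψ : hibiCone P) : hibiRing k P :=
  ⟨hibiMono k P ψ, Algebra.subset_adjoin ⟨ψ, ψ.2, rfl⟩⟩

theorem hibiMono_add (ψ η : Pbar P → ℤ) :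
    hibiMono k P (ψ + η) = hibiMono k P ψ * hibiMono k P η := by
  simp [hibiMono, AddMonoidAlgebra.single_mul_single]

theorem hibiRingMono_add (ψ η : hibiCone P) :
    hibiRingMono k (ψ + η) = hibiRingMono k ψ * hibiRingMono k η :=
  Subtype.ext (hibiMono_add _ _)

theorem hibiRingMono_zero : hibiRingMono k (0 : hibiCone P) = 1 := rfl

variable (k P) in
/-- The canonical map from the monoid algebra of the lattice points of `C(P)` to `R(P)`. -/
noncomputable def hibiRingOfMonoidAlgebra :
    AddMonoidAlgebra k (hibiCone P) →ₐ[k] hibiRing k P :=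
  AddMonoidAlgebra.lift k _ _
    { toFun := fun ψ => hibiRingMono k ψ.toAdd
      map_one' := hibiRingMono_zero
      map_mul' := fun _ _ => hibiRingMono_add _ _ }

theorem hibiRingOfMonoidAlgebra_of (ψ : hibiCone P) :
    hibiRingOfMonoidAlgebra k P (AddMonoidAlgebra.single ψ 1) = hibiRingMono k ψ := by
  simp [hibiRingOfMonoidAlgebra]

theorem hibiRing_eq_adjoin :
    Algebra.adjoin k (Set.range (hibiRingMono k : hibiCone P → hibiRing k P)) = ⊤ := by
  refine Eq.trans (congrArg _ ?_) (Algebra.adjoin_adjoin_coe_preimage (R := k)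
    (s := {f | ∃ ψ : Pbar P → ℤ, InConeP P ψ ∧ f = hibiMono k P ψ}))
  ext f
  constructor
  · rintro ⟨ψ, rfl⟩
    exact ⟨ψ, ψ.2, rfl⟩
  · rintro ⟨ψ, hψ, h⟩
    exact ⟨⟨ψ, hψ⟩, Subtype.ext h.symm⟩

theorem hibiRing_finiteType (k P : Type) [Field k] [Fintype P] [PartialOrder P] :
    Algebra.FiniteType k (hibiRing k P) := by
  have : AddMonoid.FG (hibiCone P) :=
    (AddMonoid.fg_iff_addSubmonoid_fg _).2 (hibiCone_fg P)
  refine Algebra.FiniteType.of_surjective (hibiRingOfMonoidAlgebra k P) ?_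
  rw [← AlgHom.range_eq_top, eq_top_iff, ← hibiRing_eq_adjoin, Algebra.adjoin_le_iff]
  rintro _ ⟨ψ, rfl⟩
  exact ⟨_, hibiRingOfMonoidAlgebra_of ψ⟩

/-- The face of `C(P)` of lattice points whose monomials avoid a prime ideal. -/
def hibiFace (p : Ideal (hibiRing k P)) [p.IsPrime] : AddSubmonoid (hibiCone P) where
  carrier := {ψ | hibiRingMono k ψ ∉ p}
  add_mem' := fun {ψ η} hψ hη h => by
    rw [hibiRingMono_add] at h
    exact (Ideal.IsPrime.mem_or_mem ‹_› h).elim hψ hη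
  zero_mem' := by
    rw [Set.mem_ofPred_eq, hibiRingMono_zero]
    exact p.ne_top_iff_one.1 (Ideal.IsPrime.ne_top ‹_›)

/-- Restriction of the lattice points of a face to a set of coordinates. -/
noncomputable def hibiFaceRestrict (p : Ideal (hibiRing k P)) [p.IsPrime] (σ : Type) [Finite σ]
    (i : σ → Pbar P) : hibiFace p →+ (σ →₀ ℕ) where
  toFun ψ := Finsupp.equivFunOnFinite.symm fun a => ((ψ : Pbar P → ℤ) (i a)).toNat
  map_zero' := by
    ext a
    simp
  map_add' ψ η := by
    ext a
    simpa using Int.toNat_add (ψ.1.2.nonneg _) (η.1.2.nonneg _)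

theorem ringKrullDim_quotient_le_of_restrict_injective [Fintype P] (p : Ideal (hibiRing k P))
    [p.IsPrime] (σ : Type) [Fintype σ] (i : σ → Pbar P)
    (h : ∀ ψ ∈ hibiFace p, ∀ η ∈ hibiFace p,
      (∀ a, (ψ : Pbar P → ℤ) (i a) = (η : Pbar P → ℤ) (i a)) → ψ = η) :
    ringKrullDim (hibiRing k P ⧸ p) ≤ Fintype.card σ := by
  have := hibiRing_finiteType k P
  have : Algebra.FiniteType k (hibiRing k P ⧸ p) :=
    .of_surjective (Ideal.Quotient.mkₐ k p) (Ideal.Quotient.mkₐ_surjective k p)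
  have hinj : Function.Injective (hibiFaceRestrict p σ i) := by
    intro ψ η hψη
    refine Subtype.ext (h ψ ψ.2 η η.2 fun a => ?_)
    have ha : ((ψ : Pbar P → ℤ) (i a)).toNat = ((η : Pbar P → ℤ) (i a)).toNat :=
      DFunLike.congr_fun hψη a
    have := ψ.1.2.nonneg (i a)
    have := η.1.2.nonneg (i a)
    omega
  refine ringKrullDim_le_of_subquotient_mvPolynomial (k := k) (A := hibiRing k P ⧸ p)
    (((Ideal.Quotient.mkₐ k p).comp (hibiRingOfMonoidAlgebra k P)).comp
      (AddMonoidAlgebra.mapDomainAlgHom k k (hibiFace p).subtype)) ?_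
    (AddMonoidAlgebra.mapDomainAlgHom k k (hibiFaceRestrict p σ i))
    (AddMonoidAlgebra.mapDomain_injective hinj)
  rw [← AlgHom.range_eq_top, eq_top_iff,
    ← (AlgHom.range_eq_top (Ideal.Quotient.mkₐ k p)).2 (Ideal.Quotient.mkₐ_surjective k p),
    ← Algebra.map_top, ← hibiRing_eq_adjoin, AlgHom.map_adjoin, Algebra.adjoin_le_iff]
  rintro _ ⟨_, ⟨ψ, rfl⟩, rfl⟩
  by_cases hψ : hibiRingMono k ψ ∈ p
  · have : Ideal.Quotient.mkₐ k p (hibiRingMono k ψ) = 0 := Ideal.Quotient.eq_zero_iff_mem.2 hψ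
    simp only [this]
    exact zero_mem _
  · refine ⟨AddMonoidAlgebra.single ⟨ψ, hψ⟩ 1, ?_⟩
    simp [hibiRingOfMonoidAlgebra_of]

/-- If `ψ` lies in the monoid of `ω` and multiplication by `χ^η` maps `ω` into `R(P)`, then
`χ^(η + ψ)` lies in the trace ideal. -/
theorem hibiRingMono_mem_hibiTrace (ψ η : Pbar P → ℤ) (hψ0 : ψ ⊤ = 0)
    (hψ : ∀ a b, a ⋖ b → ψ b + 1 ≤ ψ a)
    (hη : ∀ θ : Pbar P → ℤ, θ ⊤ = 0 → (∀ a b, a ⋖ b → θ b + 1 ≤ θ a) → InConeP P (η + θ))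
    (ξ : hibiCone P) (hξ : (ξ : Pbar P → ℤ) = η + ψ) : hibiRingMono k ξ ∈ hibiTrace k P := by
  have key : ∀ x ∈ hibiOmega k P, hibiMono k P η * x ∈ hibiRing k P := by
    intro x hx
    induction hx using Submodule.span_induction with
    | mem x hx =>
      obtain ⟨θ, h0, h1, rfl⟩ := hx
      rw [← hibiMono_add]
      exact Algebra.subset_adjoin ⟨_, hη θ h0 h1, rfl⟩
    | zero => simp
    | add x y _ _ hx hy => rw [mul_add]; exact add_mem hx hy
    | smul r x _ hx =>
      rw [mul_smul_comm]
      exact mul_mem r.2 hx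
  let φ : hibiOmega k P →ₗ[hibiRing k P] hibiRing k P :=
    { toFun := fun x => ⟨hibiMono k P η * x, key x x.2⟩
      map_add' := fun x y => Subtype.ext (mul_add _ _ _)
      map_smul' := fun r x => Subtype.ext (mul_smul_comm r _ _) }
  refine Ideal.subset_span ⟨φ, ⟨hibiMono k P ψ, Submodule.subset_span ⟨ψ, hψ0, hψ, rfl⟩⟩, ?_⟩
  refine Subtype.ext ?_
  change hibiMono k P η * hibiMono k P ψ = hibiMono k P ξ
  rw [hξ, hibiMono_add]

/-- The graph of covering relations along which all members of a face are constant. -/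
def hibiFaceGraph (p : Ideal (hibiRing k P)) [p.IsPrime] : SimpleGraph (Pbar P) where
  Adj a b := (a ⋖ b ∨ b ⋖ a) ∧ ∀ ψ ∈ hibiFace p, (ψ : Pbar P → ℤ) a = (ψ : Pbar P → ℤ) b
  symm := ⟨fun _ _ h => ⟨h.1.symm, fun ψ hψ => (h.2 ψ hψ).symm⟩⟩
  loopless := ⟨fun _ h => h.1.elim (fun h => h.ne rfl) (fun h => h.ne rfl)⟩

theorem eq_of_mem_support_hibiFaceGraph (p : Ideal (hibiRing k P)) [p.IsPrime] {u v : Pbar P}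
    (q : (hibiFaceGraph p).Walk u v) (ψ : hibiCone P) (hψ : ψ ∈ hibiFace p) :
    ∀ a ∈ q.support, (ψ : Pbar P → ℤ) a = (ψ : Pbar P → ℤ) u := by
  induction q with
  | nil => simp
  | cons h q ih =>
    intro a ha
    rcases List.mem_cons.1 ha with rfl | ha
    · rfl
    · exact (ih a ha).trans (h.2 ψ hψ).symm

variable [Fintype P]

theorem exists_interior_hibiFace (p : Ideal (hibiRing k P)) [p.IsPrime] :
    ∃ ξ ∈ hibiFace p, ∀ a b, a ⋖ b → ¬ (hibiFaceGraph p).Adj a b →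
      (ξ : Pbar P → ℤ) b + 1 ≤ (ξ : Pbar P → ℤ) a := by
  classical
  have := Fintype.ofFinite (Pbar P)
  have hex : ∀ c : Pbar P × Pbar P, ∃ ψ ∈ hibiFace p, c.1 ⋖ c.2 →
      ¬ (hibiFaceGraph p).Adj c.1 c.2 → (ψ : Pbar P → ℤ) c.2 + 1 ≤ (ψ : Pbar P → ℤ) c.1 := by
    rintro ⟨a, b⟩
    by_cases h : a ⋖ b ∧ ¬ (hibiFaceGraph p).Adj a b
    · obtain ⟨hab, hadj⟩ := h
      have : ∃ ψ ∈ hibiFace p, (ψ : Pbar P → ℤ) a ≠ (ψ : Pbar P → ℤ) b := by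
        by_contra! hcon
        exact hadj ⟨Or.inl hab, hcon⟩
      obtain ⟨ψ, hψ, hne⟩ := this
      exact ⟨ψ, hψ, fun _ _ => lt_of_le_of_ne (ψ.2.1 hab.le) hne.symm⟩
    · exact ⟨0, zero_mem _, fun h1 h2 => absurd ⟨h1, h2⟩ h⟩
  choose g hg hlt using hex
  refine ⟨∑ c, g c, sum_mem fun c _ => hg c, fun a b hab hadj => ?_⟩
  rw [AddSubmonoid.coe_finsetSum, Finset.sum_apply, Finset.sum_apply, ← Int.lt_iff_add_one_le]
  exact Finset.sum_lt_sum (fun c _ => (g c).2.1 hab.le)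
    ⟨(a, b), Finset.mem_univ _, hlt (a, b) hab hadj⟩

theorem exists_mem_hibiFace_mem_hibiTrace (p : Ideal (hibiRing k P)) [p.IsPrime]
    (hpath : ∀ u v (q : (hibiFaceGraph p).Walk u v), q.IsPath → q.length ≤ 3) :
    ∃ ξ ∈ hibiFace p, hibiRingMono k ξ ∈ hibiTrace k P := by
  have := Fintype.ofFinite (Pbar P)
  obtain ⟨φ₀, hφ₀⟩ := exists_grading_of_path_length_le (G := hibiFaceGraph p)
    (fun a b h => h.1) hpath
  obtain ⟨φ, hφ, htop⟩ : ∃ φ : Pbar P → ℤ,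
      (∀ a b, (hibiFaceGraph p).Adj a b → a < b → φ a = φ b + 1) ∧ φ ⊤ = 0 :=
    ⟨fun a => φ₀ a - φ₀ ⊤, fun a b h hab => by simp only [hφ₀ a b h hab]; ring, sub_self _⟩
  obtain ⟨ξ, hξ, hlt⟩ := exists_interior_hibiFace p
  obtain ⟨N, hN⟩ : ∃ N : ℕ, ∀ a, 2 * |φ a| + 1 ≤ N := by
    refine ⟨(∑ a, (2 * |φ a| + 1)).toNat, fun a => ?_⟩
    have h0 : ∀ a ∈ Finset.univ, 0 ≤ 2 * |φ a| + 1 := fun a _ => by positivity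
    rw [Int.toNat_of_nonneg (Finset.sum_nonneg h0)]
    exact Finset.single_le_sum h0 (Finset.mem_univ a)
  have hbound : ∀ a b, a ⋖ b → ¬ (hibiFaceGraph p).Adj a b →
      (N : ℤ) * (ξ : Pbar P → ℤ) b + |φ a| + |φ b| + 1 ≤ N * (ξ : Pbar P → ℤ) a := by
    intro a b hab hadj
    have h1 := hlt a b hab hadj
    have h2 := hN a
    have h3 := hN b
    nlinarith
  have htopξ : (ξ : Pbar P → ℤ) ⊤ = 0 := ξ.2.2
  refine ⟨(2 * N) • ξ, nsmul_mem hξ _, hibiRingMono_mem_hibiTrace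
    (fun a => φ a + N * (ξ : Pbar P → ℤ) a) (fun a => - φ a + N * (ξ : Pbar P → ℤ) a)
    (by simp [htop, htopξ]) ?_ ?_ _ ?_⟩
  · intro a b hab
    by_cases hadj : (hibiFaceGraph p).Adj a b
    · simp only [hφ a b hadj hab.lt, hadj.2 ξ hξ]
      linarith
    · have := hbound a b hab hadj
      have := neg_abs_le (φ a)
      have := le_abs_self (φ b)
      linarith
  · intro θ h0 hθ
    refine ⟨antitone_of_forall_covBy fun a b hab => ?_, by simp [h0, htop, htopξ]⟩
    have h1 := hθ a b hab
    simp only [Pi.add_apply]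
    by_cases hadj : (hibiFaceGraph p).Adj a b
    · rw [hφ a b hadj hab.lt, hadj.2 ξ hξ]
      linarith
    · have := hbound a b hab hadj
      have := le_abs_self (φ a)
      have := neg_abs_le (φ b)
      linarith
  · ext a
    simp
    ring

theorem ringKrullDim_quotient_add_three_le_of_isPath (p : Ideal (hibiRing k P)) [p.IsPrime]
    {u v : Pbar P} (q : (hibiFaceGraph p).Walk u v) (hq : q.IsPath) (hlen : 4 ≤ q.length) :
    ringKrullDim (hibiRing k P ⧸ p) + 3 ≤ Fintype.card P := by
  classical
  have := Fintype.ofFinite (Pbar P)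
  obtain ⟨T, hT, hdet⟩ : ∃ T : Finset (Pbar P), 5 ≤ T.card ∧
      ∀ ψ ∈ hibiFace p, ∀ η ∈ hibiFace p,
        (∀ a ∉ T, (ψ : Pbar P → ℤ) a = (η : Pbar P → ℤ) a) → ψ = η := by
    have hcard : q.support.toFinset.card = q.length + 1 := by
      rw [List.toFinset_card_of_nodup hq.support_nodup, q.length_support]
    by_cases htop : ⊤ ∈ q.support
    · refine ⟨q.support.toFinset, by omega, fun ψ hψ η hη h => Subtype.ext (funext fun a => ?_)⟩
      by_cases ha : a ∈ q.support
      · rw [eq_of_mem_support_hibiFaceGraph p q ψ hψ a ha,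
          eq_of_mem_support_hibiFaceGraph p q η hη a ha,
          ← eq_of_mem_support_hibiFaceGraph p q ψ hψ _ htop,
          ← eq_of_mem_support_hibiFaceGraph p q η hη _ htop, ψ.2.2, η.2.2]
      · exact h a (by simpa using ha)
    · have hu : u ∈ q.support.toFinset := by simp
      refine ⟨insert ⊤ (q.support.toFinset.erase u), ?_,
        fun ψ hψ η hη h => Subtype.ext (funext fun a => ?_)⟩
      · rw [Finset.card_insert_of_notMem (by simp [htop]), Finset.card_erase_of_mem hu]
        omega
      · have hu' : (ψ : Pbar P → ℤ) u = (η : Pbar P → ℤ) u := by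
          refine h u ?_
          simp only [Finset.mem_insert, Finset.mem_erase, ne_eq, not_true_eq_false, false_and,
            or_false]
          rintro rfl
          exact htop q.start_mem_support
        by_cases ha : a ∈ q.support
        · rw [eq_of_mem_support_hibiFaceGraph p q ψ hψ a ha,
            eq_of_mem_support_hibiFaceGraph p q η hη a ha, hu']
        · rcases eq_or_ne a ⊤ with rfl | hatop
          · rw [ψ.2.2, η.2.2]
          · exact h a (by simp [ha, hatop])
  have hle := ringKrullDim_quotient_le_of_restrict_injective p {a // a ∉ T} Subtype.val
    fun ψ hψ η hη h => hdet ψ hψ η hη fun a ha => h ⟨a, ha⟩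
  have hcard : Fintype.card {a // a ∉ T} + 3 ≤ Fintype.card P := by
    have h1 := card_pbar P
    have h2 := T.card_le_univ
    have h3 : Fintype.card {a // a ∉ T} = Fintype.card (Pbar P) - T.card := by
      simp
    omega
  calc ringKrullDim (hibiRing k P ⧸ p) + 3
      ≤ (Fintype.card {a // a ∉ T} : WithBot ℕ∞) + 3 := by gcongr
    _ ≤ Fintype.card P := by exact_mod_cast hcard

end Hibi

/-- If `tr(ω)` is a proper ideal of the Hibi ring `R(P)` (the
non-Gorenstein locus is non-empty), then the Krull dimension of `R(P)/tr(ω)` is at most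
`#P - 3`; equivalently, the codimension of the non-Gorenstein locus in `Spec R(P)`
(of Krull dimension `#P + 1`) is at least `4`. -/
theorem hibi_locus_codim_ge_four
    (k : Type) [Field k] [IsAlgClosed k] [CharZero k]
    (P : Type) [Fintype P] [PartialOrder P]
    (h : hibiTrace k P ≠ ⊤) :
    ringKrullDim (↥(hibiRing k P) ⧸ hibiTrace k P) + 3 ≤ (Fintype.card P : WithBot ℕ∞) := by
  have hbound : ∀ p : Ideal (hibiRing k P), p.IsPrime → hibiTrace k P ≤ p →
      ringKrullDim (hibiRing k P ⧸ p) + 3 ≤ Fintype.card P := by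
    intro p _ hp
    by_cases hpath : ∀ u v (q : (hibiFaceGraph p).Walk u v), q.IsPath → q.length ≤ 3
    · obtain ⟨ξ, hξ, hmem⟩ := exists_mem_hibiFace_mem_hibiTrace p hpath
      exact absurd (hp hmem) hξ
    · push Not at hpath
      obtain ⟨u, v, q, hq, hlen⟩ := hpath
      exact ringKrullDim_quotient_add_three_le_of_isPath p q hq hlen
  obtain ⟨m, hm, hmp⟩ := Ideal.exists_le_maximal _ h
  have hcard : 3 ≤ Fintype.card P := by
    have hle := hbound m hm.isPrime hmp
    have := Ideal.Quotient.nontrivial_iff.2 hm.ne_top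
    have h0 := ringKrullDim_nonneg_of_nontrivial (R := hibiRing k P ⧸ m)
    exact_mod_cast (le_add_of_nonneg_left h0).trans hle
  obtain ⟨n, hn⟩ := Nat.exists_eq_add_of_le' hcard
  have h3 : ∀ x : WithBot ℕ∞, x + 3 ≤ (Fintype.card P : WithBot ℕ∞) ↔ x ≤ n := by
    intro x
    rw [hn, Nat.cast_add]
    exact WithBot.add_le_add_iff_right' (α := ℕ) (WithBot.natCast_ne_bot 3)
      (WithBot.coe_injective.ne (ENat.natCast_ne_top 3))
  rw [h3]
  exact ringKrullDim_quotient_le_of_forall_isPrime _ _ fun p hp hle => (h3 _).1 (hbound p hp hle)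
end

section
/- The Krull dimension of R(P)/tr(ω) is at most 0 (i.e. the non-Gorenstein locus of the Hibi ring R(P) is zero-dimensional, possibly empty) if and only if both posets P ∪ {∞} (P with a new maximum adjoined) and P ∪ {−∞} (P with a new minimum adjoined) are graded. -/
/-- a lattice point of the interior of the cone `C(P)`, the exponents spanning `ω` -/
def InOmegaP (P : Type) [PartialOrder P] (ψ : Pbar P → ℤ) : Prop :=
  ψ ⊤ = 0 ∧ ∀ a b : Pbar P, a ⋖ b → ψ b + 1 ≤ ψ a

/-- the exponents `θ` of the form `ψ + η` with `χ^ψ ∈ ω` and `χ^η ω ⊆ R(P)` -/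
def InTraceP (P : Type) [PartialOrder P] (θ : Pbar P → ℤ) : Prop :=
  ∃ ψ, InOmegaP P ψ ∧ ∀ ψ', InOmegaP P ψ' → InConeP P (ψ' + (θ - ψ))

section Combinatorics

lemma antitone_of_covBy {Q : Type*} [PartialOrder Q] [Finite Q] {f : Q → ℤ}
    (h : ∀ a b : Q, a ⋖ b → f b ≤ f a) : Antitone f := by
  classical
  have := Fintype.ofFinite Q
  let : LocallyFiniteOrder Q := Fintype.toLocallyFiniteOrder
  exact (antitone_iff_forall_covBy f).2 h

/-- every covering relation is tight for some strictly order-reversing integral function -/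
lemma exists_strictAnti_eq_add_one {Q : Type*} [PartialOrder Q] [Finite Q] {a b : Q}
    (hab : a ⋖ b) : ∃ f : Q → ℤ, StrictAnti f ∧ f a = f b + 1 := by
  classical
  set c : Q → ℤ := fun x => ((Set.Ioi x).ncard : ℤ) with hc
  set N : ℤ := (Nat.card Q : ℤ) + 2 with hN
  have c_nonneg : ∀ x, 0 ≤ c x := fun x => Int.natCast_nonneg _
  have c_lt : ∀ x, c x < N := fun x => by
    have : (Set.Ioi x).ncard ≤ Nat.card Q := Set.ncard_le_card _
    simp only [hc, hN]; omega
  have c_anti : ∀ x y, x < y → c y < c x := fun x y hxy => by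
    have : (Set.Ioi y).ncard < (Set.Ioi x).ncard :=
      Set.ncard_lt_ncard (Set.Ioi_ssubset_Ioi hxy) (Set.toFinite _)
    simp only [hc]; omega
  refine ⟨fun x => if x = a then N + 1 else if x = b then N else
    if x < b then c x + 2 * N else c x, ?_, by simp [hab.ne']⟩
  intro x y hxy
  have hx := c_lt x
  have hy := c_lt y
  have hx' := c_nonneg x
  have hy' := c_nonneg y
  have hca := c_anti x y hxy
  have hN2 : 2 ≤ N := by omega
  have hlt := hab.lt
  have hcov : ∀ z, a < z → ¬ z < b := fun z h1 h2 => hab.2 h1 h2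
  dsimp only
  split_ifs <;> first | omega | (subst_vars; exfalso; grind)

lemma isGradedPoset_iff_of_orderEmbedding {Q Q' : Type*} [PartialOrder Q] [PartialOrder Q']
    (e : Q ↪o Q') (he : (Set.range e).OrdConnected) :
    IsGradedPoset Q ↔
      ∃ ψ : Q' → ℤ, ∀ a ∈ Set.range e, ∀ b ∈ Set.range e, a ⋖ b → ψ a = ψ b + 1 := by
  constructor
  · rintro ⟨g, hg⟩
    refine ⟨Function.extend e g 0, ?_⟩
    rintro _ ⟨a, rfl⟩ _ ⟨b, rfl⟩ hab
    rw [e.injective.extend_apply, e.injective.extend_apply]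
    exact hg a b ((he.apply_covBy_apply_iff e).1 hab)
  · rintro ⟨ψ, hψ⟩
    exact ⟨ψ ∘ e, fun a b hab => hψ _ ⟨a, rfl⟩ _ ⟨b, rfl⟩ ((he.apply_covBy_apply_iff e).2 hab)⟩

lemma isGradedPoset_withTop_iff (P : Type) [PartialOrder P] :
    IsGradedPoset (WithTop P) ↔
      ∃ ψ : Pbar P → ℤ, ∀ a b : Pbar P, a ⋖ b → a ≠ ⊥ → ψ a = ψ b + 1 := by
  have hr : Set.range (WithBot.coeOrderHom : WithTop P ↪o Pbar P) = {x | x ≠ ⊥} := by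
    ext x; induction x <;> simp
  rw [isGradedPoset_iff_of_orderEmbedding WithBot.coeOrderHom, hr]
  · refine exists_congr fun ψ => ⟨fun h a b hab ha => h a ha b (bot_lt_of_lt hab.lt).ne' hab,
      fun h a ha b _ hab => h a b hab ha⟩
  · rw [hr]
    exact ⟨fun x hx y _ z hz => (lt_of_lt_of_le (bot_lt_iff_ne_bot.2 hx) hz.1).ne'⟩

lemma isGradedPoset_withBot_iff (P : Type) [PartialOrder P] :
    IsGradedPoset (WithBot P) ↔
      ∃ ψ : Pbar P → ℤ, ∀ a b : Pbar P, a ⋖ b → b ≠ ⊤ → ψ a = ψ b + 1 := by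
  set e : WithBot P ↪o Pbar P := OrderEmbedding.withBotMap WithTop.coeOrderHom
  have hr : Set.range e = {x | x ≠ ⊤} := by
    ext x
    simp only [Set.mem_range, Set.mem_ofPred]
    constructor
    · rintro ⟨y, rfl⟩
      cases y with
      | bot => exact bot_ne_top
      | coe y => exact fun h => WithTop.coe_ne_top (WithBot.coe_injective h)
    · intro h
      induction x using WithBot.recBotCoe with
      | bot => exact ⟨⊥, rfl⟩
      | coe x =>
        induction x with
        | top => exact absurd rfl h
        | coe x => exact ⟨x, rfl⟩
  rw [isGradedPoset_iff_of_orderEmbedding e, hr]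
  · refine exists_congr fun ψ => ⟨fun h a b hab hb => h a (lt_top_of_lt hab.lt).ne b hb hab,
      fun h a _ b hb hab => h a b hab hb⟩
  · rw [hr]
    exact ⟨fun x _ y hy z hz => (lt_of_le_of_lt hz.2 (lt_top_iff_ne_top.2 hy)).ne⟩

end Combinatorics

section Exponents

variable {P : Type} [PartialOrder P]

lemma InConeP.add {ψ ψ' : Pbar P → ℤ} (h : InConeP P ψ) (h' : InConeP P ψ') :
    InConeP P (ψ + ψ') :=
  ⟨h.1.add h'.1, by simp [h.2, h'.2]⟩

lemma InConeP.zero : InConeP P 0 := ⟨antitone_const, rfl⟩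

lemma InTraceP.add {α β : Pbar P → ℤ} (hα : InConeP P α) (hβ : InTraceP P β) :
    InTraceP P (α + β) := by
  obtain ⟨ψ, hψ, h⟩ := hβ
  refine ⟨ψ, hψ, fun ψ' hψ' => ?_⟩
  convert hα.add (h ψ' hψ') using 1
  abel

variable [Finite P]

lemma InOmegaP.inConeP {ψ : Pbar P → ℤ} (h : InOmegaP P ψ) : InConeP P ψ :=
  ⟨antitone_of_covBy fun a b hab => by have := h.2 a b hab; omega, h.1⟩

lemma exists_inOmegaP_eq_add_one {a b : Pbar P} (hab : a ⋖ b) :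
    ∃ ψ, InOmegaP P ψ ∧ ψ a = ψ b + 1 := by
  obtain ⟨f, hf, hfab⟩ := exists_strictAnti_eq_add_one hab
  refine ⟨fun x => f x - f ⊤, ⟨by simp, fun x y hxy => ?_⟩, by dsimp only; omega⟩
  have := hf hxy.lt
  dsimp only
  omega

/-- if `θ` is the exponent of a monomial in the trace, then some function drops by exactly one
along all the covering relations on which `θ` is constant -/
lemma InTraceP.exists_grading {θ : Pbar P → ℤ} (h : InTraceP P θ) :
    ∃ ψ : Pbar P → ℤ, ∀ a b, a ⋖ b → θ a = θ b → ψ a = ψ b + 1 := by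
  obtain ⟨ψ, hψ, h⟩ := h
  refine ⟨ψ, fun a b hab hθ => ?_⟩
  obtain ⟨ψ', hψ', heq⟩ := exists_inOmegaP_eq_add_one hab
  have h1 := (h ψ' hψ').1 hab.le
  have h2 := hψ.2 a b hab
  simp only [Pi.add_apply, Pi.sub_apply] at h1
  omega

end Exponents

section Coefficients

lemma AddMonoidAlgebra.exists_coeff_ne_zero_of_mul {R M : Type*} [Semiring R] [Add M]
    {x y : AddMonoidAlgebra R M} {m : M} (h : (x * y).coeff m ≠ 0) :
    ∃ a b, x.coeff a ≠ 0 ∧ y.coeff b ≠ 0 ∧ a + b = m := by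
  classical
  have := AddMonoidAlgebra.support_coeff_mul_subset x y (Finsupp.mem_support_iff.2 h)
  obtain ⟨a, ha, b, hb, hab⟩ := Finset.mem_add.1 this
  exact ⟨a, b, Finsupp.mem_support_iff.1 ha, Finsupp.mem_support_iff.1 hb, hab⟩

variable {k : Type} [Field k] {P : Type} [PartialOrder P]

lemma hibiMono_mem {ψ : Pbar P → ℤ} (h : InConeP P ψ) : hibiMono k P ψ ∈ hibiRing k P :=
  Algebra.subset_adjoin ⟨ψ, h, rfl⟩

lemma hibiMono_mul (ψ ψ' : Pbar P → ℤ) :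
    hibiMono k P ψ * hibiMono k P ψ' = hibiMono k P (ψ + ψ') := by
  simp [hibiMono, AddMonoidAlgebra.single_mul_single]

lemma hibiMono_mem_omega {ψ : Pbar P → ℤ} (h : InOmegaP P ψ) :
    hibiMono k P ψ ∈ hibiOmega k P :=
  Submodule.subset_span ⟨ψ, h.1, h.2, rfl⟩

lemma eq_of_coeff_hibiMono_ne_zero {ψ θ : Pbar P → ℤ}
    (h : (hibiMono k P ψ).coeff θ ≠ 0) : ψ = θ := by
  classical
  by_contra hne
  exact h (by simp [hibiMono, hne])

lemma inConeP_of_coeff_ne_zero {f : AddMonoidAlgebra k (Pbar P → ℤ)} (hf : f ∈ hibiRing k P) :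
    ∀ θ, f.coeff θ ≠ 0 → InConeP P θ := by
  induction hf using Algebra.adjoin_induction with
  | mem x hx =>
    obtain ⟨ψ, hψ, rfl⟩ := hx
    intro θ hθ
    rwa [← eq_of_coeff_hibiMono_ne_zero hθ]
  | algebraMap r =>
    intro θ hθ
    classical
    have : (0 : Pbar P → ℤ) = θ := by
      by_contra hne
      exact hθ (by simp [hne])
    exact this ▸ InConeP.zero
  | add x y _ _ hx hy =>
    intro θ hθ
    by_cases h : x.coeff θ = 0
    · exact hy θ fun h' => hθ (by simp [h, h'])
    · exact hx θ h
  | mul x y _ _ hx hy =>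
    intro θ hθ
    obtain ⟨a, b, ha, hb, rfl⟩ := AddMonoidAlgebra.exists_coeff_ne_zero_of_mul hθ
    exact (hx a ha).add (hy b hb)

variable [Finite P]

/-- the coefficient of `φ (χ^ψ)` at `θ` is that of `φ (χ^ψ')` at `ψ' + (θ - ψ)` -/
lemma coeff_map_hibiMono (φ : ↥(hibiOmega k P) →ₗ[↥(hibiRing k P)] ↥(hibiRing k P))
    {ψ ψ' : Pbar P → ℤ} (h : InOmegaP P ψ) (h' : InOmegaP P ψ') (θ : Pbar P → ℤ) :
    (φ ⟨hibiMono k P ψ, hibiMono_mem_omega h⟩ : AddMonoidAlgebra k (Pbar P → ℤ)).coeff θ =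
      (φ ⟨hibiMono k P ψ', hibiMono_mem_omega h'⟩ :
        AddMonoidAlgebra k (Pbar P → ℤ)).coeff (ψ' + (θ - ψ)) := by
  have key : (⟨hibiMono k P ψ', hibiMono_mem h'.inConeP⟩ : ↥(hibiRing k P)) •
        (⟨hibiMono k P ψ, hibiMono_mem_omega h⟩ : ↥(hibiOmega k P)) =
      (⟨hibiMono k P ψ, hibiMono_mem h.inConeP⟩ : ↥(hibiRing k P)) •
        (⟨hibiMono k P ψ', hibiMono_mem_omega h'⟩ : ↥(hibiOmega k P)) :=
    Subtype.ext (mul_comm (hibiMono k P ψ') (hibiMono k P ψ))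
  have key' := congrArg (fun r : ↥(hibiRing k P) =>
    (r : AddMonoidAlgebra k (Pbar P → ℤ)).coeff (ψ' + θ)) (congrArg φ key)
  simp only [map_smul, smul_eq_mul, MulMemClass.coe_mul, hibiMono,
    AddMonoidAlgebra.coeff_single_mul_apply, one_mul, neg_add_cancel_left] at key'
  rw [show ψ' + (θ - ψ) = -ψ + (ψ' + θ) by abel]
  exact key'

lemma inTraceP_of_coeff_map_ne_zero
    (φ : ↥(hibiOmega k P) →ₗ[↥(hibiRing k P)] ↥(hibiRing k P))
    {x : AddMonoidAlgebra k (Pbar P → ℤ)} (hx : x ∈ hibiOmega k P) :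
    ∀ θ, (φ ⟨x, hx⟩ : AddMonoidAlgebra k (Pbar P → ℤ)).coeff θ ≠ 0 → InTraceP P θ := by
  induction hx using Submodule.span_induction with
  | mem x hx =>
    obtain ⟨ψ, h0, h1, rfl⟩ := hx
    intro θ hθ
    refine ⟨ψ, ⟨h0, h1⟩, fun ψ' hψ' => ?_⟩
    refine inConeP_of_coeff_ne_zero (φ ⟨hibiMono k P ψ', hibiMono_mem_omega hψ'⟩).2 _ ?_
    rwa [← coeff_map_hibiMono φ ⟨h0, h1⟩ hψ']
  | zero =>
    intro θ hθ
    refine absurd ?_ hθ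
    have : φ ⟨0, Submodule.zero_mem _⟩ = 0 := map_zero φ
    simp [this]
  | add x y hx hy ihx ihy =>
    intro θ hθ
    have : φ ⟨x + y, Submodule.add_mem _ hx hy⟩ = φ ⟨x, hx⟩ + φ ⟨y, hy⟩ :=
      map_add φ ⟨x, hx⟩ ⟨y, hy⟩
    rw [this] at hθ
    by_cases h : (φ ⟨x, hx⟩ : AddMonoidAlgebra k (Pbar P → ℤ)).coeff θ = 0
    · exact ihy θ fun h' => hθ (by simp [h, h'])
    · exact ihx θ h
  | smul r x hx ih =>
    intro θ hθ
    have : φ ⟨r • x, Submodule.smul_mem _ r hx⟩ = r * φ ⟨x, hx⟩ :=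
      φ.map_smul r ⟨x, hx⟩
    rw [this, MulMemClass.coe_mul] at hθ
    obtain ⟨a, b, ha, hb, rfl⟩ := AddMonoidAlgebra.exists_coeff_ne_zero_of_mul hθ
    exact (ih b hb).add (inConeP_of_coeff_ne_zero r.2 a ha)

lemma inTraceP_of_coeff_ne_zero {f : ↥(hibiRing k P)} (hf : f ∈ hibiTrace k P) :
    ∀ θ, (f : AddMonoidAlgebra k (Pbar P → ℤ)).coeff θ ≠ 0 → InTraceP P θ := by
  induction hf using Submodule.span_induction with
  | mem f hf =>
    obtain ⟨φ, x, rfl⟩ := hf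
    exact inTraceP_of_coeff_map_ne_zero φ x.2
  | zero => exact fun θ hθ => absurd (by simp) hθ
  | add x y _ _ hx hy =>
    intro θ hθ
    by_cases h : (x : AddMonoidAlgebra k (Pbar P → ℤ)).coeff θ = 0
    · exact hy θ fun h' => hθ (by simp [h, h'])
    · exact hx θ h
  | smul r x _ ih =>
    intro θ hθ
    rw [smul_eq_mul, MulMemClass.coe_mul] at hθ
    obtain ⟨a, b, ha, hb, rfl⟩ := AddMonoidAlgebra.exists_coeff_ne_zero_of_mul hθ
    exact (ih b hb).add (inConeP_of_coeff_ne_zero r.2 a ha)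

/-- multiplication by `χ^η` as a homomorphism `ω → R(P)`, for `η` in the exponents of `ω⁻¹` -/
noncomputable def hibiMulMono (η : Pbar P → ℤ) (hη : ∀ ψ, InOmegaP P ψ → InConeP P (η + ψ)) :
    ↥(hibiOmega k P) →ₗ[↥(hibiRing k P)] ↥(hibiRing k P) where
  toFun x := ⟨hibiMono k P η * x, by
    obtain ⟨x, hx⟩ := x
    induction hx using Submodule.span_induction with
    | mem x hx =>
      obtain ⟨ψ, h0, h1, rfl⟩ := hx
      rw [hibiMono_mul]
      exact hibiMono_mem (hη ψ ⟨h0, h1⟩)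
    | zero => simp
    | add x y _ _ hx hy => simpa [mul_add] using add_mem hx hy
    | smul r x _ ih =>
      have : hibiMono k P η * (r • x) = r * (hibiMono k P η * x) :=
        mul_left_comm (hibiMono k P η) (r : AddMonoidAlgebra k (Pbar P → ℤ)) x
      exact this ▸ mul_mem r.2 ih⟩
  map_add' x y := Subtype.ext (mul_add _ _ _)
  map_smul' r x := Subtype.ext (mul_left_comm (hibiMono k P η) r.1 x.1)

lemma hibiMono_add_mem_trace {ψ η : Pbar P → ℤ} (hψ : InOmegaP P ψ) (hη0 : η ⊤ = 0)
    (hη : ∀ a b : Pbar P, a ⋖ b → η b - 1 ≤ η a) (h : InConeP P (η + ψ)) :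
    (⟨hibiMono k P (η + ψ), hibiMono_mem h⟩ : ↥(hibiRing k P)) ∈ hibiTrace k P := by
  have hη' : ∀ ψ', InOmegaP P ψ' → InConeP P (η + ψ') := fun ψ' hψ' =>
    ⟨antitone_of_covBy fun a b hab => by
      have h1 := hη a b hab
      have h2 := hψ'.2 a b hab
      simp only [Pi.add_apply]
      omega, by simp [hη0, hψ'.1]⟩
  refine Ideal.subset_span ⟨hibiMulMono η hη', ⟨_, hibiMono_mem_omega hψ⟩, Subtype.ext ?_⟩
  exact hibiMono_mul η ψ

end Coefficients

section KrullDimension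

/-- in a ring whose quotient by `I` has dimension at most zero, some `t ^ n * (1 - r * t)` lies
in `I` for each `t` -/
lemma exists_pow_mul_one_sub_mem {R : Type*} [CommRing R] {I : Ideal R}
    (h : ringKrullDim (R ⧸ I) ≤ 0) (t : R) : ∃ (n : ℕ) (r : R), t ^ n * (1 - r * t) ∈ I := by
  have : Ring.KrullDimLE 0 (R ⧸ I) := Ring.krullDimLE_iff.2 (by exact_mod_cast h)
  let S : Submonoid R :=
    { carrier := {x | ∃ (n : ℕ) (r : R), t ^ n * (1 - r * t) = x}
      one_mem' := ⟨0, 0, by simp⟩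
      mul_mem' := by
        rintro _ _ ⟨n, r, rfl⟩ ⟨m, s, rfl⟩
        exact ⟨n + m, r + s - r * s * t, by ring⟩ }
  by_contra! hcon
  obtain ⟨p, hp, hIp, hdisj⟩ := Ideal.exists_le_prime_disjoint I S
    (Set.disjoint_left.2 fun x hx ⟨n, r, hnr⟩ => hcon n r (hnr ▸ hx))
  have hq : (p.map (Ideal.Quotient.mk I)).IsPrime :=
    Ideal.map_isPrime_of_surjective Ideal.Quotient.mk_surjective (by simpa using hIp)
  have hpm : p.IsMaximal := by
    have hmax := hq.isMaximal'
    have := Ideal.comap_isMaximal_of_surjective (Ideal.Quotient.mk I)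
      Ideal.Quotient.mk_surjective (K := p.map (Ideal.Quotient.mk I))
    rwa [Ideal.comap_map_of_surjective _ Ideal.Quotient.mk_surjective, ← RingHom.ker_eq_comap_bot,
      Ideal.mk_ker, sup_eq_left.2 hIp] at this
  have ht : t ∉ p := fun ht => Set.disjoint_left.1 hdisj ht ⟨1, 0, by simp⟩
  obtain ⟨r, i, hi, hri⟩ := hpm.exists_inv ht
  refine Set.disjoint_left.1 hdisj hi ⟨0, r, ?_⟩
  rw [← hri]; ring

lemma ringKrullDim_quotient_le_zero {R : Type*} [CommRing R] {I : Ideal R}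
    (h : ∀ p : Ideal R, p.IsPrime → I ≤ p → p.IsMaximal) : ringKrullDim (R ⧸ I) ≤ 0 := by
  have : Ring.KrullDimLE 0 (R ⧸ I) := Ring.krullDimLE_zero_iff.2 fun q hq =>
    Ideal.isMaximal_of_isIntegral_of_isMaximal_comap (R := R) q <|
      h _ (hq.comap _) <| by
        rw [Ideal.Quotient.algebraMap_eq]
        exact le_trans (by simp) (Ideal.ker_le_comap (Ideal.Quotient.mk I))
  exact_mod_cast Ring.krullDimLE_iff.1 this

variable {k : Type} [Field k] {P : Type} [PartialOrder P]

/-- a prime ideal containing all the nontrivial monomials is maximal -/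
lemma isMaximal_of_hibiMono_mem {p : Ideal ↥(hibiRing k P)} (hp : p.IsPrime)
    (h : ∀ (ψ : Pbar P → ℤ) (hψ : InConeP P ψ), ψ ≠ 0 →
      (⟨hibiMono k P ψ, hibiMono_mem hψ⟩ : ↥(hibiRing k P)) ∈ p) : p.IsMaximal := by
  have key : ∀ (f : AddMonoidAlgebra k (Pbar P → ℤ)) (hf : f ∈ hibiRing k P),
      ∃ c : k, (⟨f, hf⟩ : ↥(hibiRing k P)) - algebraMap k _ c ∈ p := by
    intro f hf
    induction hf using Algebra.adjoin_induction with
    | mem x hx =>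
      obtain ⟨ψ, hψ, rfl⟩ := hx
      by_cases h0 : ψ = 0
      · subst h0
        refine ⟨1, ?_⟩
        convert p.zero_mem using 1
        rw [map_one, sub_eq_zero]
        rfl
      · exact ⟨0, by simpa using h ψ hψ h0⟩
    | algebraMap r =>
      refine ⟨r, ?_⟩
      convert p.zero_mem using 1
      exact sub_eq_zero.2 rfl
    | add x y hx hy ihx ihy =>
      obtain ⟨c, hc⟩ := ihx
      obtain ⟨d, hd⟩ := ihy
      refine ⟨c + d, ?_⟩
      convert p.add_mem hc hd using 1
      rw [map_add, ← add_sub_add_comm]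
      rfl
    | mul x y hx hy ihx ihy =>
      obtain ⟨c, hc⟩ := ihx
      obtain ⟨d, hd⟩ := ihy
      refine ⟨c * d, ?_⟩
      convert p.add_mem (p.mul_mem_right ⟨y, hy⟩ hc) (p.mul_mem_left (algebraMap k _ c) hd) using 1
      rw [map_mul, sub_mul, mul_sub, sub_add_sub_cancel]
      rfl
  refine Ideal.isMaximal_iff.2 ⟨(Ideal.ne_top_iff_one p).1 hp.ne_top, fun J x hpJ hx hxJ => ?_⟩
  obtain ⟨c, hc⟩ := key x.1 x.2
  have hc0 : c ≠ 0 := by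
    rintro rfl
    exact hx (by simpa using hc)
  have hcJ : algebraMap k ↥(hibiRing k P) c ∈ J := by
    simpa using J.sub_mem hxJ (hpJ hc)
  have := J.mul_mem_left (algebraMap k _ c⁻¹) hcJ
  rwa [← map_mul, inv_mul_cancel₀ hc0, map_one] at this

variable [Finite P]

lemma exists_grading_of_ringKrullDim_le_zero
    (h : ringKrullDim (↥(hibiRing k P) ⧸ hibiTrace k P) ≤ 0)
    {θ : Pbar P → ℤ} (hθ : InConeP P θ) (hbot : θ ⊥ = 1) :
    ∃ ψ : Pbar P → ℤ, ∀ a b, a ⋖ b → θ a = θ b → ψ a = ψ b + 1 := by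
  obtain ⟨n, r, hr⟩ := exists_pow_mul_one_sub_mem h ⟨hibiMono k P θ, hibiMono_mem hθ⟩
  have hmem := inTraceP_of_coeff_ne_zero hr (n • θ) (by
    have hneg : (r : AddMonoidAlgebra k (Pbar P → ℤ)).coeff (-θ) = 0 := by
      by_contra hne
      have hc := inConeP_of_coeff_ne_zero r.2 _ hne
      have h1 := hc.1 (bot_le : (⊥ : Pbar P) ≤ ⊤)
      rw [hc.2] at h1
      simp only [Pi.neg_apply] at h1
      omega
    simp [hibiMono, AddMonoidAlgebra.single_pow, hneg, AddMonoidAlgebra.one_def])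
  obtain ⟨ψ, hψ⟩ := hmem.exists_grading
  exact ⟨ψ, fun a b hab hab' => hψ a b hab (by simp [hab'])⟩

/-- if both adjunctions are graded, every indicator function of a down-set separating `-∞` from
`∞` has a multiple which is an exponent of a monomial in the trace -/
lemma exists_pow_indicator_mem_trace
    (htop : IsGradedPoset (WithTop P)) (hbot : IsGradedPoset (WithBot P))
    {θ : Pbar P → ℤ} (hθ : InConeP P θ) (h01 : ∀ x, θ x = 0 ∨ θ x = 1) (hθbot : θ ⊥ = 1) :
    ∃ n : ℕ, (⟨hibiMono k P θ, hibiMono_mem hθ⟩ : ↥(hibiRing k P)) ^ n ∈ hibiTrace k P := by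
  obtain ⟨h, hh⟩ := (isGradedPoset_withTop_iff P).1 htop
  obtain ⟨g, hg⟩ := (isGradedPoset_withBot_iff P).1 hbot
  obtain ⟨M, hM⟩ : ∃ M : ℕ, ∀ a b, |g a - h b| ≤ M := by
    obtain ⟨M, hM⟩ := (Set.finite_range fun x : Pbar P × Pbar P => |g x.1 - h x.2|).bddAbove
    exact ⟨M.toNat, fun a b => (hM ⟨(a, b), rfl⟩).trans (Int.self_le_toNat M)⟩
  set ψ : Pbar P → ℤ := fun x => if θ x = 1 then g x - h ⊤ + M + 1 else h x - h ⊤ with hψdef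
  have hψ1 : ∀ x, θ x = 1 → ψ x = g x - h ⊤ + M + 1 := fun x hx => by simp [hψdef, hx]
  have hψ0 : ∀ x, θ x = 0 → ψ x = h x - h ⊤ := fun x hx => by simp [hψdef, hx]
  have hcases : ∀ a b : Pbar P, a ⋖ b →
      (θ a = θ b ∧ ψ a = ψ b + 1) ∨
        (θ a = 1 ∧ θ b = 0 ∧ ψ b + 1 ≤ ψ a ∧ ψ a ≤ ψ b + 2 * M + 1) := by
    intro a b hab
    have hle := hθ.1 hab.le
    have hMab := abs_le.1 (hM a b)
    rcases h01 a with ha | ha <;> rcases h01 b with hb | hb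
    · have := hh a b hab (by rintro rfl; omega)
      rw [hψ0 a ha, hψ0 b hb]
      omega
    · omega
    · rw [hψ1 a ha, hψ0 b hb]
      omega
    · have := hg a b hab (by rintro rfl; have := hθ.2; omega)
      rw [hψ1 a ha, hψ1 b hb]
      omega
  have hψ : InOmegaP P ψ := by
    refine ⟨by rw [hψ0 ⊤ hθ.2, sub_self], fun a b hab => ?_⟩
    rcases hcases a b hab with h | h <;> omega
  refine ⟨2 * M, ?_⟩
  set η : Pbar P → ℤ := (2 * M) • θ - ψ with hη
  have hsum : η + ψ = (2 * M) • θ := by simp [hη]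
  have hcone : InConeP P (η + ψ) := by
    rw [hsum]
    refine ⟨fun x y hxy => ?_, by simp [hθ.2]⟩
    exact nsmul_le_nsmul_right (hθ.1 hxy) _
  have hmem := hibiMono_add_mem_trace (k := k) hψ (by simp [hη, hθ.2, hψ.1]) (fun a b hab => by
    simp only [hη, Pi.sub_apply, Pi.smul_apply]
    rcases hcases a b hab with ⟨h1, h2⟩ | ⟨h1, h2, h3, h4⟩
    · rw [h1]
      omega
    · rw [h1, h2]
      simp only [nsmul_eq_mul, Nat.cast_mul, Nat.cast_ofNat]
      omega) hcone
  convert hmem using 1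
  refine Subtype.ext ?_
  simp only [SubmonoidClass.coe_pow, hsum]
  simp [hibiMono, AddMonoidAlgebra.single_pow]

end KrullDimension

/-- The non-Gorenstein locus of the Hibi ring `R(P)` is at most
zero-dimensional (Krull dimension of `R(P)/tr(ω)` at most `0`, possibly empty) iff both
`P ∪ {∞}` and `P ∪ {-∞}` are graded posets. -/
theorem hibi_locus_zero_dim_iff
    (k : Type) [Field k] [IsAlgClosed k] [CharZero k]
    (P : Type) [Fintype P] [PartialOrder P] :
    ringKrullDim (↥(hibiRing k P) ⧸ hibiTrace k P) ≤ 0 ↔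
      IsGradedPoset (WithTop P) ∧ IsGradedPoset (WithBot P) := by
  classical
  constructor
  · intro h
    constructor
    · rw [isGradedPoset_withTop_iff]
      obtain ⟨ψ, hψ⟩ := exists_grading_of_ringKrullDim_le_zero h
        (θ := fun x => if x = ⊥ then 1 else 0)
        ⟨fun x y hxy => by
          dsimp only
          split_ifs with h1 h2
          · rfl
          · exact absurd (le_bot_iff.1 (h1 ▸ hxy)) h2
          · exact zero_le_one
          · rfl, by simp⟩ (by simp)
      exact ⟨ψ, fun a b hab ha => hψ a b hab (by simp [ha, (bot_lt_of_lt hab.lt).ne'])⟩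
    · rw [isGradedPoset_withBot_iff]
      obtain ⟨ψ, hψ⟩ := exists_grading_of_ringKrullDim_le_zero h
        (θ := fun x => if x = ⊤ then 0 else 1)
        ⟨fun x y hxy => by
          dsimp only
          split_ifs with h1 h2 h2
          · rfl
          · exact zero_le_one
          · exact absurd (top_le_iff.1 (h2 ▸ hxy)) h1
          · rfl, by simp⟩ (by simp)
      exact ⟨ψ, fun a b hab hb => hψ a b hab (by simp [hb, (lt_top_of_lt hab.lt).ne])⟩
  · rintro ⟨htop, hbot⟩
    refine ringKrullDim_quotient_le_zero fun p hp hle => isMaximal_of_hibiMono_mem hp ?_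
    intro ψ hψ hne
    have hnonneg : ∀ x, 0 ≤ ψ x := fun x => hψ.2 ▸ hψ.1 le_top
    have hψbot : 1 ≤ ψ ⊥ := by
      by_contra! hlt
      refine hne (funext fun x => ?_)
      have := hψ.1 (bot_le : ⊥ ≤ x)
      have := hnonneg x
      simp only [Pi.zero_apply]
      omega
    set θ : Pbar P → ℤ := fun x => if 1 ≤ ψ x then 1 else 0 with hθdef
    have hθ : InConeP P θ := by
      refine ⟨fun x y hxy => ?_, by simp [hθdef, hψ.2]⟩
      have := hψ.1 hxy
      simp only [hθdef]
      split_ifs <;> omega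
    have hrest : InConeP P (ψ - θ) := by
      refine ⟨fun x y hxy => ?_, by simp [hψ.2, hθ.2]⟩
      have := hψ.1 hxy
      have := hnonneg y
      simp only [hθdef, Pi.sub_apply]
      split_ifs <;> omega
    obtain ⟨n, hn⟩ := exists_pow_indicator_mem_trace (k := k) htop hbot hθ
      (fun x => by simp only [hθdef]; split_ifs <;> simp) (by simp [hθdef, hψbot])
    have hfac : (⟨hibiMono k P ψ, hibiMono_mem hψ⟩ : ↥(hibiRing k P)) =
        ⟨hibiMono k P (ψ - θ), hibiMono_mem hrest⟩ * ⟨hibiMono k P θ, hibiMono_mem hθ⟩ :=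
      Subtype.ext (by simp [hibiMono_mul])
    rw [hfac]
    exact p.mul_mem_left _ (hp.mem_of_pow_mem n (hle hn))
end
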